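/- For every τ ∈ ℍ: (1/(2πi))·x′(τ) − 4t(τ)·x(τ) = −x(τ)y(τ)/2 and (1/(2πi))·y′(τ) − 4t(τ)·y(τ) = −x(τ)y(τ)/2. -/

import Mathlib

open Complex

noncomputable section

/-- The theta constant `θ(τ) = ∑_{n ∈ ℤ} exp(πin²τ)`. -/
def theta (τ : ℂ) : ℂ := ∑' n : ℤ, Complex.exp (Real.pi * Complex.I * (n : ℂ) ^ 2 * τ)

/-- `θ₂(τ) = ∑_{n ∈ ℤ} exp(πi(n+1/2)²τ)`. -/
def theta2 (τ : ℂ) : ℂ := ∑' n : ℤ, Complex.exp (Real.pi * Complex.I * ((n : ℂ) + 1/2) ^ 2 * τ)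

/-- `θ₄(τ) = ∑_{n ∈ ℤ} (-1)ⁿ exp(πin²τ)`. -/
def theta4 (τ : ℂ) : ℂ :=
  ∑' n : ℤ, (-1 : ℂ) ^ n * Complex.exp (Real.pi * Complex.I * (n : ℂ) ^ 2 * τ)

/-- `x(τ) = -θ₄(τ)⁴`. -/
def xx (τ : ℂ) : ℂ := -(theta4 τ) ^ 4

/-- `y(τ) = θ₂(τ)⁴`. -/
def yy (τ : ℂ) : ℂ := (theta2 τ) ^ 4

/-- `t(τ) = (1/(2πi)) θ'(τ)/θ(τ)`. -/
def tt (τ : ℂ) : ℂ := deriv theta τ / (2 * Real.pi * Complex.I * theta τ)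

/-- Sparse power series over ℤ. -/
def SS (e : ℤ → ℕ) (q : ℂ) : ℂ := ∑' n : ℤ, q ^ e n

lemma SS_summable_bound (r : ℝ) (h0 : 0 < r) (h1 : r < 1) :
    Summable (fun n : ℤ => r ^ n.natAbs / r) := by
  apply Summable.div_const
  apply Summable.of_nat_of_neg <;> simpa using summable_geometric_of_lt_one h0.le h1

lemma SS_term_bound (e : ℤ → ℕ) (he : ∀ n, n.natAbs ≤ e n + 1) (r : ℝ) (h0 : 0 < r) (h1 : r < 1)
    (n : ℤ) (q : ℂ) (hq : ‖q‖ ≤ r) : ‖q ^ e n‖ ≤ r ^ n.natAbs / r := by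
  rw [norm_pow, le_div_iff₀ h0]
  calc ‖q‖ ^ e n * r ≤ r ^ e n * r := by gcongr
    _ = r ^ (e n + 1) := by rw [pow_succ]
    _ ≤ r ^ n.natAbs := pow_le_pow_of_le_one h0.le h1.le (he n)

lemma exists_radius (q : ℂ) (hq : ‖q‖ < 1) : ∃ r : ℝ, 0 < r ∧ r < 1 ∧ ‖q‖ < r := by
  obtain ⟨r, h1, h2⟩ := exists_between hq
  exact ⟨r, lt_of_le_of_lt (norm_nonneg _) h1, h2, h1⟩

lemma SS_summable (e : ℤ → ℕ) (he : ∀ n, n.natAbs ≤ e n + 1) (q : ℂ) (hq : ‖q‖ < 1) :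
    Summable (fun n : ℤ => ‖q ^ e n‖) := by
  obtain ⟨r, h0, h1, h⟩ := exists_radius q hq
  exact Summable.of_nonneg_of_le (fun _ => norm_nonneg _)
    (fun n => SS_term_bound e he r h0 h1 n q h.le) (SS_summable_bound r h0 h1)

lemma SS_diffOn (e : ℤ → ℕ) (he : ∀ n, n.natAbs ≤ e n + 1) :
    DifferentiableOn ℂ (SS e) (Metric.ball 0 1) := by
  intro q hq
  have hqn : ‖q‖ < 1 := by simpa using hq
  obtain ⟨r, h0, h1, h⟩ := exists_radius q hqn
  have := Complex.differentiableOn_tsum_of_summable_norm (SS_summable_bound r h0 h1)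
    (F := fun (n : ℤ) (q : ℂ) => q ^ e n) (U := Metric.ball 0 r)
    (fun n => (differentiable_id.pow _).differentiableOn) Metric.isOpen_ball
    (fun n w hw => SS_term_bound e he r h0 h1 n w (by simpa using (Metric.mem_ball.1 hw).le))
  exact (this.differentiableAt (Metric.isOpen_ball.mem_nhds (by simpa using h))).differentiableWithinAt

lemma SS_diffAt (e : ℤ → ℕ) (he : ∀ n, n.natAbs ≤ e n + 1) (q : ℂ) (hq : ‖q‖ < 1) :
    DifferentiableAt ℂ (SS e) q :=
  (SS_diffOn e he).differentiableAt (Metric.isOpen_ball.mem_nhds (by simpa using hq))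

lemma SS_deriv_cont (e : ℤ → ℕ) (he : ∀ n, n.natAbs ≤ e n + 1) :
    ContinuousAt (deriv (SS e)) 0 :=
  (((SS_diffOn e he).analyticAt (Metric.isOpen_ball.mem_nhds (by simp))).deriv).continuousAt

lemma SS_deriv_zero (e : ℤ → ℕ) (he : ∀ n, n.natAbs ≤ e n + 1) :
    HasSum (fun n : ℤ => (e n : ℂ) * 0 ^ (e n - 1)) (deriv (SS e) 0) := by
  have := Complex.hasSum_deriv_of_summable_norm
    (SS_summable_bound (1/2) (by norm_num) (by norm_num))
    (F := fun (n : ℤ) (q : ℂ) => q ^ e n) (U := Metric.ball 0 (1/2))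
    (fun n => (differentiable_id.pow _).differentiableOn) Metric.isOpen_ball
    (fun n w hw => SS_term_bound e he (1/2) (by norm_num) (by norm_num) n w
      (by simpa using (Metric.mem_ball.1 hw).le)) (z := 0) (by simp)
  simp at this
  exact this

def e3 (n : ℤ) : ℕ := n.natAbs ^ 2
def e2 (n : ℤ) : ℕ := (n * (n + 1)).natAbs

lemma he3 (n : ℤ) : n.natAbs ≤ e3 n + 1 := by
  unfold e3; nlinarith [sq_nonneg ((n.natAbs : ℤ) - 1)]

lemma e2_cast (n : ℤ) : (e2 n : ℤ) = n * (n + 1) := by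
  unfold e2
  rw [Int.natAbs_of_nonneg]
  rcases le_or_gt 0 n with h | h <;> nlinarith

lemma he2 (n : ℤ) : n.natAbs ≤ e2 n + 1 := by
  zify
  rw [e2_cast]
  rcases abs_cases n with ⟨h, hh⟩ | ⟨h, hh⟩ <;> rw [h] <;> nlinarith

lemma e3_cast (n : ℤ) : (e3 n : ℤ) = n ^ 2 := by
  unfold e3; push_cast; simp

def qq (τ : ℂ) : ℂ := Complex.exp (Real.pi * Complex.I * τ)

lemma qq_norm (τ : ℂ) (hτ : 0 < τ.im) : ‖qq τ‖ < 1 := by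
  unfold qq
  rw [Complex.norm_exp]
  simp
  positivity

lemma term3 (τ : ℂ) (n : ℤ) :
    Complex.exp (Real.pi * Complex.I * (n : ℂ) ^ 2 * τ) = qq τ ^ e3 n := by
  unfold qq
  rw [← Complex.exp_nat_mul]
  have : ((e3 n : ℕ) : ℂ) = (n : ℂ) ^ 2 := by exact_mod_cast congrArg (Int.cast (R := ℂ)) (e3_cast n)
  rw [this]; ring_nf

lemma term4 (τ : ℂ) (n : ℤ) :
    (-1 : ℂ) ^ n * Complex.exp (Real.pi * Complex.I * (n : ℂ) ^ 2 * τ) = (-qq τ) ^ e3 n := by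
  rw [term3, neg_pow (qq τ)]
  congr 1
  unfold e3
  rcases Int.even_or_odd n with h | h
  · rw [h.neg_one_zpow, Even.neg_one_pow]
    exact (Int.natAbs_even.2 h).pow_of_ne_zero two_ne_zero
  · rw [h.neg_one_zpow, Odd.neg_one_pow]
    exact (Int.natAbs_odd.2 h).pow

lemma term2 (τ : ℂ) (n : ℤ) :
    Complex.exp (Real.pi * Complex.I * ((n : ℂ) + 1/2) ^ 2 * τ) =
      Complex.exp (Real.pi * Complex.I * τ / 4) * qq τ ^ e2 n := by
  unfold qq
  rw [← Complex.exp_nat_mul, ← Complex.exp_add]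
  have : ((e2 n : ℕ) : ℂ) = (n : ℂ) * (n + 1) := by
    exact_mod_cast congrArg (Int.cast (R := ℂ)) (e2_cast n)
  rw [this]; ring_nf

lemma theta_eq (τ : ℂ) : theta τ = SS e3 (qq τ) := by
  unfold theta SS; simp_rw [term3]

lemma theta4_eq (τ : ℂ) : theta4 τ = SS e3 (-qq τ) := by
  unfold theta4 SS; simp_rw [term4]

lemma theta2_eq (τ : ℂ) :
    theta2 τ = Complex.exp (Real.pi * Complex.I * τ / 4) * SS e2 (qq τ) := by
  unfold theta2 SS; simp_rw [term2]; rw [tsum_mul_left]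

lemma theta2_pow (τ : ℂ) : theta2 τ ^ 4 = qq τ * SS e2 (qq τ) ^ 4 := by
  rw [theta2_eq, mul_pow, ← Complex.exp_nat_mul]
  unfold qq; congr 2; push_cast; ring

/-- terms -/
def T3 (τ : ℂ) (n : ℤ) : ℂ := Complex.exp (Real.pi * Complex.I * (n : ℂ) ^ 2 * τ)
def T2 (τ : ℂ) (n : ℤ) : ℂ := Complex.exp (Real.pi * Complex.I * ((n : ℂ) + 1/2) ^ 2 * τ)
def sg (n : ℤ) : ℂ := (-1 : ℂ) ^ n

lemma sT3 (τ : ℂ) (hτ : 0 < τ.im) : Summable (fun n => ‖T3 τ n‖) := by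
  simp_rw [T3, term3]
  exact SS_summable e3 he3 _ (qq_norm τ hτ)

lemma sT2 (τ : ℂ) (hτ : 0 < τ.im) : Summable (fun n => ‖T2 τ n‖) := by
  simp_rw [T2, term2, norm_mul _ (_ ^ _)]
  exact (SS_summable e2 he2 _ (qq_norm τ hτ)).mul_left _

lemma sg_norm (n : ℤ) : ‖sg n‖ = 1 := by simp [sg]

lemma sT4 (τ : ℂ) (hτ : 0 < τ.im) : Summable (fun n => ‖sg n * T3 τ n‖) := by
  simpa [norm_mul, sg_norm] using sT3 τ hτ

lemma sT5 (τ : ℂ) (hτ : 0 < τ.im) : Summable (fun n => ‖sg n * T2 τ n‖) := by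
  simpa [norm_mul, sg_norm] using sT2 τ hτ

lemma split_sum (f : ℤ × ℤ → ℂ) (hf : Summable f) :
    ∑' p, f p = (∑' p : ℤ × ℤ, f (p.1 + p.2, p.1 - p.2)) +
      ∑' p : ℤ × ℤ, f (p.1 + p.2 + 1, p.1 - p.2) := by
  let g : (ℤ × ℤ) ⊕ (ℤ × ℤ) → ℤ × ℤ :=
    Sum.elim (fun p => (p.1 + p.2, p.1 - p.2)) (fun p => (p.1 + p.2 + 1, p.1 - p.2))
  have hg : Function.Bijective g := by
    constructor
    · rintro (⟨a, b⟩ | ⟨a, b⟩) (⟨c, d⟩ | ⟨c, d⟩) h <;> simp [g] at h ⊢ <;> omega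
    · rintro ⟨m, n⟩
      rcases Int.even_or_odd' (m + n) with ⟨k, hk | hk⟩
      · exact ⟨Sum.inl (k, m - k), by simp [g]; omega⟩
      · exact ⟨Sum.inr (k, m - k - 1), by simp [g]; omega⟩
  have hs : Summable (fun x => f (g x)) := hf.comp_injective hg.1
  rw [← (Equiv.ofBijective g hg).tsum_eq f]
  change ∑' x, f (g x) = _
  rw [Summable.tsum_sum (hs.comp_injective Sum.inl_injective) (hs.comp_injective Sum.inr_injective)]
  rfl

lemma prod_split (f g : ℤ → ℂ) (hf : Summable (fun n => ‖f n‖)) (hg : Summable (fun n => ‖g n‖))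
    (a b c d : ℤ → ℂ) (ha : Summable (fun n => ‖a n‖)) (hb : Summable (fun n => ‖b n‖))
    (hc : Summable (fun n => ‖c n‖)) (hd : Summable (fun n => ‖d n‖))
    (h1 : ∀ j k, f (j + k) * g (j - k) = a j * b k)
    (h2 : ∀ j k, f (j + k + 1) * g (j - k) = c j * d k) :
    (∑' n, f n) * ∑' n, g n = (∑' n, a n) * (∑' n, b n) + (∑' n, c n) * ∑' n, d n := by
  rw [tsum_mul_tsum_of_summable_norm hf hg, tsum_mul_tsum_of_summable_norm ha hb,
    tsum_mul_tsum_of_summable_norm hc hd,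
    split_sum (fun p => f p.1 * g p.2) (summable_mul_of_summable_norm hf hg)]
  simp only [h1, h2]

lemma sg_add (m n : ℤ) : sg (m + n) = sg m * sg n := by simp [sg, zpow_add₀]
lemma sg_sub (m n : ℤ) : sg (m - n) = sg m * sg n := by
  rw [sub_eq_add_neg, sg_add]
  congr 1
  unfold sg
  rw [zpow_neg, ← inv_zpow]; norm_num
lemma sg_one : sg 1 = -1 := by simp [sg]
lemma sg_sq (n : ℤ) : sg n * sg n = 1 := by
  rw [← sg_sub]; simp [sg]

lemma T33 (τ : ℂ) (j k : ℤ) : T3 τ (j + k) * T3 τ (j - k) = T3 (2 * τ) j * T3 (2 * τ) k := by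
  unfold T3; rw [← Complex.exp_add, ← Complex.exp_add]; push_cast; ring_nf
lemma T33odd (τ : ℂ) (j k : ℤ) : T3 τ (j + k + 1) * T3 τ (j - k) = T2 (2 * τ) j * T2 (2 * τ) k := by
  unfold T3 T2; rw [← Complex.exp_add, ← Complex.exp_add]; push_cast; ring_nf
lemma T22 (τ : ℂ) (j k : ℤ) : T2 τ (j + k) * T2 τ (j - k) = T2 (2 * τ) j * T3 (2 * τ) k := by
  unfold T3 T2; rw [← Complex.exp_add, ← Complex.exp_add]; push_cast; ring_nf
lemma T22odd (τ : ℂ) (j k : ℤ) :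
    T2 τ (j + k + 1) * T2 τ (j - k) = T3 (2 * τ) (j + 1) * T2 (2 * τ) k := by
  unfold T3 T2; rw [← Complex.exp_add, ← Complex.exp_add]; push_cast; ring_nf

lemma im2 {τ : ℂ} (hτ : 0 < τ.im) : 0 < (2 * τ).im := by simpa using hτ

lemma dbl_a (τ : ℂ) (hτ : 0 < τ.im) :
    theta τ ^ 2 = theta (2 * τ) ^ 2 + theta2 (2 * τ) ^ 2 := by
  have := prod_split _ _ (sT3 τ hτ) (sT3 τ hτ) _ _ _ _ (sT3 _ (im2 hτ)) (sT3 _ (im2 hτ))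
    (sT2 _ (im2 hτ)) (sT2 _ (im2 hτ)) (T33 τ) (T33odd τ)
  simp only [sq]; exact this

lemma dbl_b (τ : ℂ) (hτ : 0 < τ.im) :
    theta4 τ ^ 2 = theta (2 * τ) ^ 2 - theta2 (2 * τ) ^ 2 := by
  have := prod_split _ _ (sT4 τ hτ) (sT4 τ hτ) (T3 (2 * τ)) (T3 (2 * τ))
    (fun n => - T2 (2 * τ) n) (T2 (2 * τ)) (sT3 _ (im2 hτ)) (sT3 _ (im2 hτ))
    (by simpa using (sT2 _ (im2 hτ))) (sT2 _ (im2 hτ))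
    (fun j k => by
      rw [← T33, sg_add, sg_sub]
      linear_combination (T3 τ (j + k) * T3 τ (j - k)) * (sg_sq j * sg k * sg k + sg_sq k))
    (fun j k => by
      rw [neg_mul, ← T33odd, sg_add, sg_add, sg_sub, sg_one]
      linear_combination -(T3 τ (j + k + 1) * T3 τ (j - k)) * (sg_sq j * sg k * sg k + sg_sq k))
  rw [tsum_neg, neg_mul, ← sub_eq_add_neg] at this
  simp only [sq]; exact this

lemma alt_zero (τ : ℂ) : ∑' n, sg n * T2 τ n = 0 := by
  have h := (Equiv.subLeft (-1 : ℤ)).tsum_eq (fun n => sg n * T2 τ n)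
  have h2 : ∀ n : ℤ, sg (-1 - n) * T2 τ (-1 - n) = - (sg n * T2 τ n) := by
    intro n
    rw [sg_sub]
    have : T2 τ (-1 - n) = T2 τ n := by unfold T2; push_cast; ring_nf
    rw [this]; simp [sg]
  simp only [Equiv.subLeft_apply, h2, tsum_neg] at h
  exact self_eq_neg.1 h.symm

lemma dbl_c (τ : ℂ) (hτ : 0 < τ.im) :
    theta τ * theta4 τ = theta4 (2 * τ) ^ 2 := by
  have := prod_split _ _ (sT3 τ hτ) (sT4 τ hτ) (fun n => sg n * T3 (2 * τ) n)
    (fun n => sg n * T3 (2 * τ) n) (fun n => sg n * T2 (2 * τ) n) (fun n => sg n * T2 (2 * τ) n)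
    (sT4 _ (im2 hτ)) (sT4 _ (im2 hτ)) (sT5 _ (im2 hτ)) (sT5 _ (im2 hτ))
    (fun j k => by
      rw [sg_sub]; linear_combination sg j * sg k * T33 τ j k)
    (fun j k => by
      rw [sg_sub]; linear_combination sg j * sg k * T33odd τ j k)
  rw [alt_zero, mul_zero, add_zero] at this
  simp only [sq]; exact this

lemma dbl_d (τ : ℂ) (hτ : 0 < τ.im) :
    theta2 τ ^ 2 = 2 * theta2 (2 * τ) * theta (2 * τ) := by
  have := prod_split _ _ (sT2 τ hτ) (sT2 τ hτ) (T2 (2 * τ)) (T3 (2 * τ))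
    (fun n => T3 (2 * τ) (n + 1)) (T2 (2 * τ)) (sT2 _ (im2 hτ)) (sT3 _ (im2 hτ))
    ((sT3 _ (im2 hτ)).comp_injective (add_left_injective (1 : ℤ))) (sT2 _ (im2 hτ))
    (T22 τ) (T22odd τ)
  have hs := (Equiv.addRight (1 : ℤ)).tsum_eq (T3 (2 * τ))
  simp only [Equiv.coe_addRight] at hs
  rw [hs] at this
  have h : theta2 τ * theta2 τ =
    theta2 (2 * τ) * theta (2 * τ) + theta (2 * τ) * theta2 (2 * τ) := this
  linear_combination h

lemma im_pow {τ : ℂ} (hτ : 0 < τ.im) (n : ℕ) : 0 < ((2 : ℂ) ^ n * τ).im := by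
  induction n with
  | zero => simpa using hτ
  | succ n ih => rw [pow_succ', mul_assoc]; exact im2 ih

lemma qq_dbl (τ : ℂ) (n : ℕ) : qq (2 ^ n * τ) = qq τ ^ (2 ^ n) := by
  unfold qq; rw [← Complex.exp_nat_mul]; push_cast; ring_nf

lemma qq_tendsto (τ : ℂ) (hτ : 0 < τ.im) :
    Filter.Tendsto (fun n : ℕ => qq (2 ^ n * τ)) Filter.atTop (nhds 0) := by
  simp_rw [qq_dbl]
  exact (tendsto_pow_atTop_nhds_zero_of_norm_lt_one (qq_norm τ hτ)).comp
    (tendsto_pow_atTop_atTop_of_one_lt (by norm_num))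

lemma SS3_zero : SS e3 0 = 1 := by
  unfold SS
  rw [tsum_eq_single 0]
  · simp [e3]
  · intro n hn; simp [e3, hn]

lemma SS2_zero : SS e2 0 = 2 := by
  unfold SS
  rw [tsum_eq_sum (s := {0, -1})]
  · simp [e2]; norm_num
  · intro n hn
    simp at hn
    have : e2 n ≠ 0 := by
      unfold e2; rw [Int.natAbs_ne_zero]; exact mul_ne_zero hn.1 (by omega)
    simp [this]

lemma SS3_deriv_zero : deriv (SS e3) 0 = 2 := by
  rw [← (SS_deriv_zero e3 he3).tsum_eq, tsum_eq_sum (s := {1, -1})]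
  · simp [e3]; norm_num
  · intro n hn
    simp at hn
    by_cases h0 : n = 0
    · simp [h0, e3]
    have : 2 ≤ n.natAbs := by omega
    have : e3 n - 1 ≠ 0 := by
      unfold e3
      have : 4 ≤ n.natAbs ^ 2 := by nlinarith
      omega
    simp [this]

lemma SS_cont (e : ℤ → ℕ) (he : ∀ n, n.natAbs ≤ e n + 1) : ContinuousAt (SS e) 0 :=
  (SS_diffAt e he 0 (by simp)).continuousAt

lemma SS_cont_neg (e : ℤ → ℕ) (he : ∀ n, n.natAbs ≤ e n + 1) :
    ContinuousAt (fun q => SS e (-q)) 0 :=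
  ContinuousAt.comp' (f := fun q : ℂ => -q) (by simpa using SS_cont e he) continuous_neg.continuousAt

lemma SS_deriv_cont_neg (e : ℤ → ℕ) (he : ∀ n, n.natAbs ≤ e n + 1) :
    ContinuousAt (fun q => deriv (SS e) (-q)) 0 :=
  ContinuousAt.comp' (f := fun q : ℂ => -q) (by simpa using SS_deriv_cont e he)
    continuous_neg.continuousAt

lemma theta4_ne (τ : ℂ) (hτ : 0 < τ.im) : theta4 τ ≠ 0 := by
  intro h
  have hn : ∀ n : ℕ, theta4 (2 ^ n * τ) = 0 := by
    intro n
    induction n with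
    | zero => simpa using h
    | succ n ih =>
      have := dbl_c _ (im_pow hτ n)
      rw [ih, mul_zero] at this
      rw [pow_succ', mul_assoc]
      exact pow_eq_zero_iff two_ne_zero |>.1 this.symm
  have ht := (SS_cont_neg e3 he3).tendsto.comp (qq_tendsto τ hτ)
  simp only [Function.comp_def, ← theta4_eq, hn, neg_zero, SS3_zero] at ht
  exact zero_ne_one (tendsto_nhds_unique tendsto_const_nhds ht)

lemma theta_ne (τ : ℂ) (hτ : 0 < τ.im) : theta τ ≠ 0 := by
  intro h
  have := dbl_c τ hτ
  rw [h, zero_mul] at this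
  exact theta4_ne _ (im2 hτ) (pow_eq_zero_iff two_ne_zero |>.1 this.symm)

lemma theta2_ne (τ : ℂ) (hτ : 0 < τ.im) : theta2 τ ≠ 0 := by
  intro h
  have hn : ∀ n : ℕ, theta2 (2 ^ n * τ) = 0 := by
    intro n
    induction n with
    | zero => simpa using h
    | succ n ih =>
      have := dbl_d _ (im_pow hτ n)
      rw [ih] at this
      rw [pow_succ', mul_assoc]
      have h3 := theta_ne _ (im2 (im_pow hτ n))
      simpa [h3] using this
  have hS : ∀ n : ℕ, SS e2 (qq (2 ^ n * τ)) = 0 := by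
    intro n
    have := hn n
    rw [theta2_eq] at this
    exact (mul_eq_zero.1 this).resolve_left (Complex.exp_ne_zero _)
  have ht := (SS_cont e2 he2).tendsto.comp (qq_tendsto τ hτ)
  simp only [Function.comp_def, hS, SS2_zero] at ht
  exact two_ne_zero (tendsto_nhds_unique tendsto_const_nhds ht).symm

lemma jacobi (τ : ℂ) (hτ : 0 < τ.im) : theta2 τ ^ 4 = theta τ ^ 4 - theta4 τ ^ 4 := by
  have h1 := dbl_a τ hτ
  have h2 := dbl_b τ hτ
  have h3 := dbl_d τ hτ
  have e1 : theta2 τ ^ 4 = (theta2 τ ^ 2) ^ 2 := by ring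
  have e2 : theta τ ^ 4 = (theta τ ^ 2) ^ 2 := by ring
  have e3 : theta4 τ ^ 4 = (theta4 τ ^ 2) ^ 2 := by ring
  rw [e1, e2, e3, h1, h2, h3]; ring

lemma qq_deriv (τ : ℂ) : HasDerivAt qq (Real.pi * Complex.I * qq τ) τ := by
  have := (((hasDerivAt_id τ).const_mul (Real.pi * Complex.I)).cexp)
  simp only [mul_one, id] at this
  rw [mul_comm]
  exact this

lemma theta_hd (τ : ℂ) (hτ : 0 < τ.im) :
    HasDerivAt theta (deriv (SS e3) (qq τ) * (Real.pi * Complex.I * qq τ)) τ := by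
  have := (SS_diffAt e3 he3 _ (qq_norm τ hτ)).hasDerivAt.comp τ (qq_deriv τ)
  exact this.congr_of_eventuallyEq (Filter.Eventually.of_forall theta_eq)

lemma theta4_hd (τ : ℂ) (hτ : 0 < τ.im) :
    HasDerivAt theta4 (deriv (SS e3) (-qq τ) * (-(Real.pi * Complex.I * qq τ))) τ := by
  have := (SS_diffAt e3 he3 (-qq τ) (by simpa using qq_norm τ hτ)).hasDerivAt.comp τ (qq_deriv τ).neg
  exact this.congr_of_eventuallyEq (Filter.Eventually.of_forall theta4_eq)

lemma theta_d (τ : ℂ) (hτ : 0 < τ.im) : HasDerivAt theta (deriv theta τ) τ :=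
  (theta_hd τ hτ).differentiableAt.hasDerivAt
lemma theta4_d (τ : ℂ) (hτ : 0 < τ.im) : HasDerivAt theta4 (deriv theta4 τ) τ :=
  (theta4_hd τ hτ).differentiableAt.hasDerivAt

lemma uhp_ev (τ : ℂ) (hτ : 0 < τ.im) : ∀ᶠ z in nhds τ, 0 < z.im :=
  (isOpen_lt continuous_const Complex.continuous_im).mem_nhds hτ

lemma theta_d2 (τ : ℂ) (hτ : 0 < τ.im) :
    HasDerivAt (fun z => theta (2 * z)) (deriv theta (2 * τ) * 2) τ := by
  have := (theta_d _ (im2 hτ)).comp τ ((hasDerivAt_id τ).const_mul 2)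
  simpa [Function.comp_def] using this
lemma theta4_d2 (τ : ℂ) (hτ : 0 < τ.im) :
    HasDerivAt (fun z => theta4 (2 * z)) (deriv theta4 (2 * τ) * 2) τ := by
  have := (theta4_d _ (im2 hτ)).comp τ ((hasDerivAt_id τ).const_mul 2)
  simpa [Function.comp_def] using this

def RR (τ : ℂ) : ℂ :=
  (deriv theta4 τ / theta4 τ - deriv theta τ / theta τ) / theta2 τ ^ 4

lemma RR_dbl (τ : ℂ) (hτ : 0 < τ.im) : RR (2 * τ) = RR τ := by
  have hd1 : deriv theta τ * theta4 τ + theta τ * deriv theta4 τ =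
      4 * theta4 (2 * τ) * deriv theta4 (2 * τ) := by
    have h1 := (theta_d τ hτ).mul (theta4_d τ hτ)
    have h2 := (theta4_d2 τ hτ).pow 2
    have h3 := h2.congr_of_eventuallyEq ((uhp_ev τ hτ).mono fun z hz => dbl_c z hz)
    have := h1.unique h3
    rw [this]; push_cast; ring
  have hd2 : theta τ * deriv theta τ + theta4 τ * deriv theta4 τ =
      4 * theta (2 * τ) * deriv theta (2 * τ) := by
    have h1 := ((theta_d τ hτ).pow 2).add ((theta4_d τ hτ).pow 2)
    have h2 := ((theta_d2 τ hτ).pow 2).const_mul 2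
    have h3 := h2.congr_of_eventuallyEq ((uhp_ev τ hτ).mono fun z hz => 
      show theta z ^ 2 + theta4 z ^ 2 = 2 * theta (2 * z) ^ 2 by
        rw [dbl_a z hz, dbl_b z hz]; ring)
    have := h1.unique h3
    push_cast at this
    linear_combination this / 2
  have a := dbl_a τ hτ
  have b := dbl_b τ hτ
  have c := dbl_c τ hτ
  have d := dbl_d τ hτ
  have n1 := theta_ne τ hτ
  have n2 := theta2_ne τ hτ
  have n4 := theta4_ne τ hτ
  have m1 := theta_ne _ (im2 hτ)
  have m2 := theta2_ne _ (im2 hτ)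
  have m4 := theta4_ne _ (im2 hτ)
  unfold RR
  generalize deriv theta4 (2 * τ) = dB at *
  generalize deriv theta (2 * τ) = dA at *
  generalize theta4 (2 * τ) = B at *
  generalize theta (2 * τ) = A at *
  generalize theta2 (2 * τ) = C at *
  generalize deriv theta4 τ = db at *
  generalize deriv theta τ = da at *
  generalize theta4 τ = u at *
  generalize theta τ = v at *
  generalize theta2 τ = w at *
  have hB : dB / B = (da * u + v * db) / (4 * (v * u)) := by
    rw [hd1, c]; field_simp
  have hA : dA / A = (v * da + u * db) / (4 * A ^ 2) := by
    rw [hd2]; field_simp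
  have hw : w ^ 4 = 4 * C ^ 2 * A ^ 2 := by
    rw [show w ^ 4 = (w ^ 2) ^ 2 by ring, d]; ring
  rw [hB, hA, hw]
  field_simp
  have e1 : A ^ 2 = (v ^ 2 + u ^ 2) / 2 := by rw [a, b]; ring
  have e2 : C ^ 2 = (v ^ 2 - u ^ 2) / 2 := by rw [a, b]; ring
  simp only [e1, e2]
  ring

lemma RR_pow (τ : ℂ) (hτ : 0 < τ.im) (n : ℕ) : RR (2 ^ n * τ) = RR τ := by
  induction n with
  | zero => simp
  | succ n ih => rw [pow_succ', mul_assoc, RR_dbl _ (im_pow hτ n), ih]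

def Phi (q : ℂ) : ℂ :=
  (-(Real.pi * Complex.I)) * (deriv (SS e3) (-q) / SS e3 (-q) + deriv (SS e3) q / SS e3 q) / SS e2 q ^ 4

lemma RR_eq_Phi (τ : ℂ) (hτ : 0 < τ.im) : RR τ = Phi (qq τ) := by
  unfold RR Phi
  have hq : qq τ ≠ 0 := Complex.exp_ne_zero _
  rw [(theta4_hd τ hτ).deriv, (theta_hd τ hτ).deriv, theta2_pow, theta_eq, theta4_eq,
    mul_comm (qq τ), ← div_div, div_right_comm]
  congr 1
  rw [div_eq_iff hq]; ring

lemma Phi_cont : ContinuousAt Phi 0 := by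
  unfold Phi
  refine ContinuousAt.div (continuousAt_const.mul (ContinuousAt.add ?_ ?_))
    ((SS_cont e2 he2).pow 4) ?_
  · exact (SS_deriv_cont_neg e3 he3).div (SS_cont_neg e3 he3) (by simp [SS3_zero])
  · exact (SS_deriv_cont e3 he3).div (SS_cont e3 he3) (by simp [SS3_zero])
  · simp [SS2_zero]

lemma RR_val (τ : ℂ) (hτ : 0 < τ.im) : RR τ = -(Real.pi * Complex.I) / 4 := by
  have ht := Phi_cont.tendsto.comp (qq_tendsto τ hτ)
  have h : ∀ n : ℕ, Phi (qq (2 ^ n * τ)) = RR τ := fun n => by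
    rw [← RR_eq_Phi _ (im_pow hτ n), RR_pow τ hτ]
  simp only [Function.comp_def, h] at ht
  rw [tendsto_nhds_unique tendsto_const_nhds ht]
  unfold Phi
  simp only [neg_zero, SS3_zero, SS2_zero, SS3_deriv_zero]
  ring

/-- `D₂* x = D₂* y = -xy/2` on the upper half-plane. -/
theorem modular_derivative_of_generators (τ : ℂ) (hτ : 0 < τ.im) :
    deriv xx τ / (2 * Real.pi * Complex.I) - 4 * tt τ * xx τ = -(xx τ * yy τ) / 2 ∧
    deriv yy τ / (2 * Real.pi * Complex.I) - 4 * tt τ * yy τ = -(xx τ * yy τ) / 2 := by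
  have n1 := theta_ne τ hτ
  have n2 := theta2_ne τ hτ
  have n4 := theta4_ne τ hτ
  have hj := jacobi τ hτ
  have hR := RR_val τ hτ
  have hx : deriv xx τ = -(4 * theta4 τ ^ 3 * deriv theta4 τ) := by
    have := ((theta4_d τ hτ).pow 4).neg
    exact (this.deriv).trans (by push_cast; ring)
  have hy : deriv yy τ = 4 * theta τ ^ 3 * deriv theta τ - 4 * theta4 τ ^ 3 * deriv theta4 τ := by
    have := (((theta_d τ hτ).pow 4).sub ((theta4_d τ hτ).pow 4)).congr_of_eventuallyEq
      ((uhp_ev τ hτ).mono fun z hz => (show yy z = theta z ^ 4 - theta4 z ^ 4 from jacobi z hz))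
    exact (this.deriv).trans (by push_cast; ring)
  have hpi : (Real.pi : ℂ) ≠ 0 := by exact_mod_cast Real.pi_ne_zero
  have hI := Complex.I_ne_zero
  have hb : deriv theta4 τ = theta4 τ * (deriv theta τ / theta τ
      - Real.pi * Complex.I / 4 * theta2 τ ^ 4) := by
    unfold RR at hR
    rw [div_eq_iff (pow_ne_zero 4 n2)] at hR
    have : deriv theta4 τ / theta4 τ = deriv theta τ / theta τ
      - Real.pi * Complex.I / 4 * theta2 τ ^ 4 := by linear_combination hR
    rw [← this]; field_simp
  rw [hx, hy, hb]
  unfold tt xx yy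
  constructor
  · field_simp
    ring
  · rw [hj]
    field_simp
    ring
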